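/- arXiv:1507.01641 — 2 statements merged into one kernel-verified Lean document; each statement's English description precedes it below -/
import Mathlib

section
/- Let k be a commutative ring with ℚ ⊆ k, V a k-module, w ≥ 1 an integer, and κ : V → V a k-linear endomorphism satisfying (κ^{w+1} − id) ∘ (κ^w − id) = 0. Then V decomposes as the internal direct sum V = ker((κ − id)²) ⊕ im((κ − id)²); that is, the submodules ker((κ − id)²) and im((κ − id)²) are complementary. -/
open Polynomial in
theorem Polynomial.isCoprime_X_sub_C_of_isUnit_eval {R : Type*} [CommRing R] {a : R} {p : R[X]}
    (h : IsUnit (p.eval a)) : IsCoprime (X - C a) p := by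
  obtain ⟨r, hr⟩ := X_sub_C_dvd_sub_C_eval (a := a) (p := p)
  obtain ⟨b, hb⟩ := h.exists_left_inv
  have hC : C b * C (p.eval a) = 1 := by rw [← C_mul, hb, C_1]
  exact ⟨-(C b * r), C b, by linear_combination hC + C b * hr⟩

open Polynomial in
theorem Polynomial.isCoprime_X_sub_one_geom_sum {R : Type*} [CommRing R] [Algebra ℚ R] {n : ℕ}
    (hn : n ≠ 0) : IsCoprime (X - 1 : R[X]) (∑ i ∈ Finset.range n, X ^ i) := by
  have h : IsUnit (n : R) := by
    simpa using (IsUnit.mk0 (n : ℚ) (Nat.cast_ne_zero.mpr hn)).map (algebraMap ℚ R)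
  rw [← C_1]
  apply isCoprime_X_sub_C_of_isUnit_eval
  simpa [eval_finsetSum] using h

open Polynomial in
theorem Polynomial.isCompl_ker_range_aeval_of_isCoprime {R M : Type*} [CommRing R]
    [AddCommGroup M] [Module R M] (f : Module.End R M) {p q : R[X]} (hpq : IsCoprime p q)
    (h : aeval f (p * q) = 0) :
    IsCompl (LinearMap.ker (aeval f p)) (LinearMap.range (aeval f p)) := by
  constructor
  · refine (disjoint_ker_aeval_of_isCoprime f hpq).mono_right ?_
    rw [LinearMap.range_le_ker_iff, ← Module.End.mul_eq_comp, ← map_mul, mul_comm, h]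
  · rw [codisjoint_comm, codisjoint_iff, eq_top_iff, ← sup_aeval_range_eq_top_of_isCoprime f hpq]
    refine sup_le_sup_left ?_ _
    rw [LinearMap.range_le_ker_iff, ← Module.End.mul_eq_comp, ← map_mul, h]

/-- Let `k` be a commutative ring with `ℚ ⊆ k`, `V` a `k`-module, `w ≥ 1`, and `κ` a `k`-linear
endomorphism of `V` satisfying `(κ^{w+1} - 1)(κ^w - 1) = 0`.  Then `V` decomposes as the
internal direct sum of `ker((κ - 1)²)` and `im((κ - 1)²)`: these submodules are
complementary. -/
theorem statement3 (k : Type) [CommRing k] [Algebra ℚ k]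
    (V : Type) [AddCommGroup V] [Module k V]
    (w : ℕ) (hw : 1 ≤ w)
    (κ : Module.End k V)
    (hκ : (κ ^ (w + 1) - 1) * (κ ^ w - 1) = 0) :
    IsCompl (LinearMap.ker ((κ - 1) ^ 2)) (LinearMap.range ((κ - 1) ^ 2)) := by
  have hcop := ((Polynomial.isCoprime_X_sub_one_geom_sum (R := k) w.succ_ne_zero).mul_right
    (Polynomial.isCoprime_X_sub_one_geom_sum (R := k) (Nat.one_le_iff_ne_zero.mp hw))).pow_left
    (m := 2)
  have hcompl := Polynomial.isCompl_ker_range_aeval_of_isCoprime κ hcop (by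
    have hfactor : ((Polynomial.X - 1) ^ 2 * ((∑ i ∈ Finset.range (w + 1), Polynomial.X ^ i) *
        ∑ i ∈ Finset.range w, Polynomial.X ^ i) : Polynomial k) =
          (Polynomial.X ^ (w + 1) - 1) * (Polynomial.X ^ w - 1) := by
      rw [← mul_geom_sum, ← mul_geom_sum]
      ring
    rw [hfactor]
    simpa using hκ)
  simpa using hcompl
end

section
/- Let V be a module over a commutative ring and let d, δ, G be endomorphisms of V such that d ∘ d = 0, δ ∘ δ = 0, G commutes with d and with δ, and G ∘ (d ∘ δ + δ ∘ d) = id. Then V = im(d) ⊕ im(δ) (internal direct sum). Moreover, δ maps im(d) bijectively onto im(δ) with inverse given by the restriction of G ∘ d, and d maps im(δ) bijectively onto im(d) with inverse given by the restriction of G ∘ δ. -/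
section

variable {R V : Type*} [CommRing R] [AddCommGroup V] [Module R V] {d δ G : Module.End R V}

theorem mul_apply_eq_self_of_mem_range (hd : d * d = 0) (hG : G * (d * δ + δ * d) = 1)
    {x : V} (hx : x ∈ LinearMap.range d) : (G * d) (δ x) = x := by
  obtain ⟨v, rfl⟩ := hx
  have hdd : d (d v) = 0 := LinearMap.congr_fun hd v
  simpa [hdd] using LinearMap.congr_fun hG (d v)

theorem apply_mul_eq_self_of_mem_range (hδ : δ * δ = 0) (hGδ : G * δ = δ * G)
    (hG : G * (d * δ + δ * d) = 1) {y : V} (hy : y ∈ LinearMap.range δ) :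
    δ ((G * d) y) = y := by
  have hcomm : G (δ (d y)) = δ (G (d y)) := LinearMap.congr_fun hGδ (d y)
  rw [add_comm] at hG
  exact hcomm.symm.trans (mul_apply_eq_self_of_mem_range hδ hG hy)

theorem bijOn_range_range (hd : d * d = 0) (hδ : δ * δ = 0) (hGd : G * d = d * G)
    (hGδ : G * δ = δ * G) (hG : G * (d * δ + δ * d) = 1) :
    Set.BijOn δ (LinearMap.range d : Set V) (LinearMap.range δ : Set V) :=
  Set.InvOn.bijOn (f' := G * d)
    ⟨fun _ hx ↦ mul_apply_eq_self_of_mem_range hd hG hx,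
      fun _ hy ↦ apply_mul_eq_self_of_mem_range hδ hGδ hG hy⟩
    (fun x _ ↦ ⟨x, rfl⟩)
    (fun y _ ↦ ⟨G y, (LinearMap.congr_fun hGd y).symm⟩)

theorem isCompl_range_range (hd : d * d = 0) (hδ : δ * δ = 0) (hGd : G * d = d * G)
    (hGδ : G * δ = δ * G) (hG : G * (d * δ + δ * d) = 1) :
    IsCompl (LinearMap.range d) (LinearMap.range δ) := by
  refine ⟨Submodule.disjoint_def.mpr fun x hx hx' ↦ ?_, ?_⟩
  · obtain ⟨w, rfl⟩ := hx'
    have hδδ : δ (δ w) = 0 := LinearMap.congr_fun hδ w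
    rw [← mul_apply_eq_self_of_mem_range hd hG hx, hδδ, map_zero]
  · refine codisjoint_iff.mpr (eq_top_iff.mpr fun v _ ↦ Submodule.mem_sup.mpr
      ⟨d (G (δ v)), ⟨_, rfl⟩, δ (G (d v)), ⟨_, rfl⟩, ?_⟩)
    have hd' : G (d (δ v)) = d (G (δ v)) := LinearMap.congr_fun hGd (δ v)
    have hδ' : G (δ (d v)) = δ (G (d v)) := LinearMap.congr_fun hGδ (d v)
    rw [← hd', ← hδ', ← map_add]
    exact LinearMap.congr_fun hG v

end

/-- Let `V` be a module over a commutative ring and `d, δ, G` endomorphisms of `V` with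
`d² = 0`, `δ² = 0`, `G` commuting with `d` and `δ`, and `G ∘ (dδ + δd) = id`.  Then
`V = im d ⊕ im δ` (the two images are complementary submodules); moreover `δ` maps `im d`
bijectively onto `im δ` with inverse the restriction of `G ∘ d`, and `d` maps `im δ`
bijectively onto `im d` with inverse the restriction of `G ∘ δ`. -/
theorem statement4 (R : Type) [CommRing R]
    (V : Type) [AddCommGroup V] [Module R V]
    (d δ G : Module.End R V)
    (hd : d * d = 0) (hδ : δ * δ = 0)
    (hGd : G * d = d * G) (hGδ : G * δ = δ * G)
    (hG : G * (d * δ + δ * d) = 1) :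
    IsCompl (LinearMap.range d) (LinearMap.range δ) ∧
    Set.BijOn δ (LinearMap.range d : Set V) (LinearMap.range δ : Set V) ∧
    (∀ x ∈ LinearMap.range d, (G * d) (δ x) = x) ∧
    (∀ y ∈ LinearMap.range δ, δ ((G * d) y) = y) ∧
    Set.BijOn d (LinearMap.range δ : Set V) (LinearMap.range d : Set V) ∧
    (∀ y ∈ LinearMap.range δ, (G * δ) (d y) = y) ∧
    (∀ x ∈ LinearMap.range d, d ((G * δ) x) = x) := by
  have hG' : G * (δ * d + d * δ) = 1 := by rwa [add_comm]
  exact ⟨isCompl_range_range hd hδ hGd hGδ hG,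
    bijOn_range_range hd hδ hGd hGδ hG,
    fun _ hx ↦ mul_apply_eq_self_of_mem_range hd hG hx,
    fun _ hy ↦ apply_mul_eq_self_of_mem_range hδ hGδ hG hy,
    bijOn_range_range hδ hd hGδ hGd hG',
    fun _ hy ↦ mul_apply_eq_self_of_mem_range hδ hG' hy,
    fun _ hx ↦ apply_mul_eq_self_of_mem_range hd hGd hG' hx⟩
end
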